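/- arXiv:1707.04226 — 2 statements merged into one kernel-verified Lean document; each statement's English description precedes it below -/
import Mathlib

section
/- Assume ‖·‖ is an admissible norm on ℝ³ and let f : M → ℝ³ be an immersed surface with Birkhoff normal field η. Let λ₁ ≥ λ₂ be the principal curvatures of M at p. Then for every nonzero V ∈ T_pM the Minkowski normal curvature satisfies λ₂ ≤ k_{M,p}(V) ≤ λ₁; moreover, when λ₁ ≠ λ₂, equality k_{M,p}(V) = λ₁ (respectively k_{M,p}(V) = λ₂) holds only when V is a principal direction associated with λ₁ (respectively with λ₂). -/
/-!
Differential geometry of immersed surfaces in three-dimensional normed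
(Minkowski) spaces, following Balestro–Martini–Teixeira.

`E3 = ℝ³` carries its standard Euclidean inner product and, in addition, a
norm `N` which is strictly convex and smooth.  Surfaces are given in a local
parametrization `f : P2 → E3` (an immersion on an open set `U`), endowed with
a Birkhoff normal field `η`.
-/

noncomputable section

open scoped InnerProductSpace

abbrev E3 := EuclideanSpace ℝ (Fin 3)
abbrev P2 := EuclideanSpace ℝ (Fin 2)

/-- A smooth, strictly convex norm on `ℝ³` (a Minkowski norm). -/
structure MinkowskiNorm3 where
  N : E3 → ℝ
  nonneg : ∀ x, 0 ≤ N x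
  eq_zero_iff : ∀ x, N x = 0 ↔ x = 0
  smul_eq : ∀ (c : ℝ) (x : E3), N (c • x) = |c| * N x
  triangle : ∀ x y, N (x + y) ≤ N x + N y
  strict_triangle : ∀ x y : E3, LinearIndependent ℝ ![x, y] → N (x + y) < N x + N y
  smooth : ContDiffOn ℝ (⊤ : ℕ∞) N {x : E3 | x ≠ 0}

namespace MinkowskiNorm3

/-- Birkhoff orthogonality of a vector `v` to a set (e.g. a plane) `H`:
`‖v + w‖ ≥ ‖v‖` for all `w ∈ H`. -/
def BirkhoffOrth (m : MinkowskiNorm3) (v : E3) (H : Set E3) : Prop :=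
  ∀ w ∈ H, m.N v ≤ m.N (v + w)

/-- The (outward) Euclidean Gauss map of the unit sphere `∂B` of the norm,
expressed on ambient space as the normalized gradient of `N`.  Restricted to
`∂B` it is the map `u⁻¹ : ∂B → ∂B_e`, whose inverse is `u : ∂B_e → ∂B`. -/
def sphereGauss (m : MinkowskiNorm3) (v : E3) : E3 :=
  ‖gradient m.N v‖⁻¹ • gradient m.N v

/-- The differential `du⁻¹` at a point `v ∈ ∂B`, applied to a vector `w`
(its restriction to the tangent plane of `∂B` at `v` is the inverse of
`du_{u⁻¹(v)}`). -/
def duInv (m : MinkowskiNorm3) (v w : E3) : E3 :=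
  fderiv ℝ m.sphereGauss v w

/-- Admissibility of the norm: the unit sphere `∂B` has positive Euclidean
Gaussian curvature at every point; equivalently, the second fundamental form
of `∂B` with respect to the outward normal is positive definite, i.e.
`⟪du⁻¹ w, w⟫ > 0` for every nonzero vector `w` tangent to `∂B`. -/
def Admissible (m : MinkowskiNorm3) : Prop :=
  ∀ v : E3, m.N v = 1 → ∀ w : E3, w ≠ 0 → fderiv ℝ m.N v w = 0 →
    0 < ⟪m.duInv v w, w⟫_ℝ

end MinkowskiNorm3

/-- An immersed surface (in a local parametrization on an open set `U ⊆ ℝ²`)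
in the Minkowski space `(ℝ³, m)`, endowed with a Birkhoff normal vector
field `η`: a smooth unit field with `η(p) ⊣_B T_pM` for all `p`. -/
structure BSurface (m : MinkowskiNorm3) where
  U : Set P2
  isOpen : IsOpen U
  f : P2 → E3
  smooth_f : ContDiffOn ℝ (⊤ : ℕ∞) f U
  immersion : ∀ p ∈ U, Function.Injective (fderiv ℝ f p)
  η : P2 → E3
  smooth_η : ContDiffOn ℝ (⊤ : ℕ∞) η U
  unit_η : ∀ p ∈ U, m.N (η p) = 1
  birkhoff : ∀ p ∈ U, m.BirkhoffOrth (η p) (Set.range (fderiv ℝ f p))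

namespace BSurface

variable {m : MinkowskiNorm3}

/-- The tangent plane `T_pM`, identified (via the push-forward `df_p`) with a
linear plane in ambient `ℝ³`. -/
def tangent (S : BSurface m) (p : P2) : Set E3 := Set.range (fderiv ℝ S.f p)

/-- `h : P2 → P2 → ℝ` (in the parameter coordinates, i.e. `h v w` stands for
`h(df_p v, df_p w)`) is the affine fundamental form of the immersion at `p`,
determined by the Gauss formula `D_X Y = ∇_X Y + h(X,Y) η`: for coordinate
directions `v, w`, the second derivative `D_v D_w f` minus `h v w • η p` is
tangential. -/
def IsAffineFundForm (S : BSurface m) (p : P2) (h : P2 → P2 → ℝ) : Prop :=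
  ∀ v w : P2,
    fderiv ℝ (fun q => fderiv ℝ S.f q w) p v - h v w • S.η p ∈ S.tangent p

end BSurface

/-- The Minkowski normal curvature of the surface parametrized by `f` with
Birkhoff normal field `η`, at `p`, in the tangent direction `X = df_p v`:
`k_{M,p}(X) = ⟪du⁻¹_{η(p)} X, dη_p X⟫ / ⟪du⁻¹_{η(p)} X, X⟫`, using the natural
identification of the parallel planes `T_pM ≅ T_{η(p)}∂B ≅ T_{ξ(p)}∂B_e`. -/
def normalCurv (m : MinkowskiNorm3) (f η : P2 → E3) (p v : P2) : ℝ :=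
  ⟪m.duInv (η p) (fderiv ℝ f p v), fderiv ℝ η p v⟫_ℝ /
    ⟪m.duInv (η p) (fderiv ℝ f p v), fderiv ℝ f p v⟫_ℝ

namespace MinkowskiNorm3

variable (m : MinkowskiNorm3)

theorem ne_zero_of_N_eq_one {v : E3} (hv : m.N v = 1) : v ≠ 0 := by
  rintro rfl
  simp [(m.eq_zero_iff 0).2 rfl] at hv

theorem contDiffAt_N {v : E3} (hv : v ≠ 0) : ContDiffAt ℝ (⊤ : ℕ∞) m.N v :=
  m.smooth.contDiffAt (isOpen_ne.mem_nhds hv)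

theorem differentiableAt_N {v : E3} (hv : v ≠ 0) : DifferentiableAt ℝ m.N v :=
  (m.contDiffAt_N hv).differentiableAt (by simp)

theorem differentiableAt_fderiv_N {v : E3} (hv : v ≠ 0) :
    DifferentiableAt ℝ (fderiv ℝ m.N) v :=
  ((m.contDiffAt_N hv).fderiv_right (m := 1) (by norm_cast)).differentiableAt (by simp)

/-- Euler's identity for the norm, which is homogeneous of degree one. -/
theorem fderiv_N_self {v : E3} (hv : v ≠ 0) : fderiv ℝ m.N v v = m.N v := by
  have h1 : HasDerivAt (fun t : ℝ => m.N (t • v)) (fderiv ℝ m.N v v) 1 := by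
    have hc : HasDerivAt (fun t : ℝ => t • v) v 1 := by
      simpa using (hasDerivAt_id (1 : ℝ)).smul_const v
    have hN : HasFDerivAt m.N (fderiv ℝ m.N v) ((1 : ℝ) • v) := by
      simpa using (m.differentiableAt_N hv).hasFDerivAt
    exact hN.comp_hasDerivAt (1 : ℝ) hc
  have h2 : HasDerivAt (fun t : ℝ => m.N (t • v)) (m.N v) 1 := by
    have hl : HasDerivAt (fun t : ℝ => t * m.N v) (m.N v) 1 := by
      simpa using (hasDerivAt_id (1 : ℝ)).mul_const (m.N v)
    refine hl.congr_of_eventuallyEq ?_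
    filter_upwards [lt_mem_nhds (one_pos : (0 : ℝ) < 1)] with t ht
    rw [m.smul_eq, abs_of_pos ht]
  exact h1.unique h2

theorem inner_gradient_N (v y : E3) : ⟪gradient m.N v, y⟫_ℝ = fderiv ℝ m.N v y := by
  simp [gradient]

theorem gradient_N_ne_zero {v : E3} (hv : v ≠ 0) : gradient m.N v ≠ 0 := by
  intro h
  have := m.inner_gradient_N v v
  rw [h, inner_zero_left, m.fderiv_N_self hv] at this
  exact hv ((m.eq_zero_iff v).1 this.symm)

/-- On vectors tangent to the sphere, `⟪du⁻¹ x, y⟫` is the Hessian of the norm divided by the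
length of its gradient. -/
theorem inner_duInv {v : E3} (hv : v ≠ 0) (x : E3) {y : E3} (hy : fderiv ℝ m.N v y = 0) :
    ⟪m.duInv v x, y⟫_ℝ = ‖gradient m.N v‖⁻¹ * fderiv ℝ (fderiv ℝ m.N) v x y := by
  have hD := m.differentiableAt_fderiv_N hv
  have hG : DifferentiableAt ℝ (gradient m.N) v :=
    ((InnerProductSpace.toDual ℝ E3).symm.toContinuousLinearEquiv.differentiableAt).comp v hD
  have hr : DifferentiableAt ℝ (fun u => ‖gradient m.N u‖⁻¹) v :=
    (hG.norm ℝ (m.gradient_N_ne_zero hv)).inv (norm_ne_zero_iff.2 (m.gradient_N_ne_zero hv))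
  have hs : DifferentiableAt ℝ m.sphereGauss v := hr.smul hG
  have h1 : HasFDerivAt (fun u => ⟪m.sphereGauss u, y⟫_ℝ) _ v :=
    hs.hasFDerivAt.inner ℝ (hasFDerivAt_const y v)
  have h2 : HasFDerivAt (fun u => ‖gradient m.N u‖⁻¹ * fderiv ℝ m.N u y) _ v :=
    hr.hasFDerivAt.mul (hD.hasFDerivAt.clm_apply (hasFDerivAt_const y v))
  have he : (fun u => ⟪m.sphereGauss u, y⟫_ℝ) =
      fun u => ‖gradient m.N u‖⁻¹ * fderiv ℝ m.N u y := by
    funext u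
    rw [sphereGauss, real_inner_smul_left, inner_gradient_N]
  rw [he] at h1
  have h3 := DFunLike.congr_fun (h1.unique h2) x
  simpa [hy, duInv] using h3

theorem fderiv_fderiv_N_comm {v : E3} (hv : v ≠ 0) (x y : E3) :
    fderiv ℝ (fderiv ℝ m.N) v x y = fderiv ℝ (fderiv ℝ m.N) v y x :=
  ((m.contDiffAt_N hv).isSymmSndFDerivAt (by simp; norm_cast)).eq x y

end MinkowskiNorm3

namespace BSurface

variable {m : MinkowskiNorm3} (S : BSurface m) {p : P2}

theorem η_ne_zero (hp : p ∈ S.U) : S.η p ≠ 0 :=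
  m.ne_zero_of_N_eq_one (S.unit_η p hp)

/-- Birkhoff orthogonality: the tangent plane is parallel to the one of the unit sphere. -/
theorem fderiv_N_fderiv_f (hp : p ∈ S.U) (v : P2) :
    fderiv ℝ m.N (S.η p) (fderiv ℝ S.f p v) = 0 := by
  have hmin : IsLocalMin (fun w : P2 => m.N (S.η p + fderiv ℝ S.f p w)) 0 := by
    refine Filter.Eventually.of_forall fun w => ?_
    simpa using S.birkhoff p hp _ ⟨w, rfl⟩
  have hN : HasFDerivAt m.N (fderiv ℝ m.N (S.η p)) (S.η p + fderiv ℝ S.f p 0) := by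
    simpa using (m.differentiableAt_N (S.η_ne_zero hp)).hasFDerivAt
  have hd : HasFDerivAt (fun w : P2 => m.N (S.η p + fderiv ℝ S.f p w)) _ 0 :=
    hN.comp (0 : P2) ((fderiv ℝ S.f p).hasFDerivAt.const_add (S.η p))
  exact DFunLike.congr_fun (hmin.hasFDerivAt_eq_zero hd) v

/-- The shape operator `dη` is self-adjoint for the Hessian of the norm. -/
theorem fderiv_fderiv_N_fderiv_η_comm (hp : p ∈ S.U) (v w : P2) :
    fderiv ℝ (fderiv ℝ m.N) (S.η p) (fderiv ℝ S.η p v) (fderiv ℝ S.f p w) =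
      fderiv ℝ (fderiv ℝ m.N) (S.η p) (fderiv ℝ S.η p w) (fderiv ℝ S.f p v) := by
  have hU := S.isOpen.mem_nhds hp
  have hf : ContDiffAt ℝ (⊤ : ℕ∞) S.f p := S.smooth_f.contDiffAt hU
  have hη : DifferentiableAt ℝ S.η p := (S.smooth_η.contDiffAt hU).differentiableAt (by simp)
  have hf' : DifferentiableAt ℝ (fderiv ℝ S.f) p :=
    (hf.fderiv_right (m := 1) (by norm_cast)).differentiableAt (by simp)
  have key : ∀ v w : P2,
      fderiv ℝ (fderiv ℝ m.N) (S.η p) (fderiv ℝ S.η p v) (fderiv ℝ S.f p w) =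
        -fderiv ℝ m.N (S.η p) (fderiv ℝ (fderiv ℝ S.f) p v w) := by
    intro v w
    have hN := (m.differentiableAt_fderiv_N (S.η_ne_zero hp)).hasFDerivAt.comp p hη.hasFDerivAt
    have h1 : HasFDerivAt (fun q => fderiv ℝ m.N (S.η q) (fderiv ℝ S.f q w)) _ p :=
      hN.clm_apply (hf'.hasFDerivAt.clm_apply (hasFDerivAt_const w p))
    have h0 : HasFDerivAt (fun q => fderiv ℝ m.N (S.η q) (fderiv ℝ S.f q w))
        (0 : P2 →L[ℝ] ℝ) p := by
      refine (hasFDerivAt_const (0 : ℝ) p).congr_of_eventuallyEq ?_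
      filter_upwards [hU] with q hq using S.fderiv_N_fderiv_f hq w
    have h2 := DFunLike.congr_fun (h1.unique h0) v
    simp at h2
    linarith
  rw [key v w, key w v, (hf.isSymmSndFDerivAt (by simp; norm_cast)).eq v w]

/-- `du⁻¹` is symmetric on the tangent plane. -/
theorem inner_duInv_fderiv_f_comm (hp : p ∈ S.U) (v w : P2) :
    ⟪m.duInv (S.η p) (fderiv ℝ S.f p v), fderiv ℝ S.f p w⟫_ℝ =
      ⟪m.duInv (S.η p) (fderiv ℝ S.f p w), fderiv ℝ S.f p v⟫_ℝ := by
  have hη := S.η_ne_zero hp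
  rw [m.inner_duInv hη _ (S.fderiv_N_fderiv_f hp w), m.inner_duInv hη _ (S.fderiv_N_fderiv_f hp v),
    m.fderiv_fderiv_N_comm hη]

/-- Principal directions for distinct principal curvatures are conjugate for `du⁻¹`. -/
theorem inner_duInv_principal_eq_zero (hp : p ∈ S.U) {a b : ℝ} (hab : a ≠ b) {v w : P2}
    (hv : fderiv ℝ S.η p v = a • fderiv ℝ S.f p v)
    (hw : fderiv ℝ S.η p w = b • fderiv ℝ S.f p w) :
    ⟪m.duInv (S.η p) (fderiv ℝ S.f p v), fderiv ℝ S.f p w⟫_ℝ = 0 := by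
  have hη := S.η_ne_zero hp
  have h := S.fderiv_fderiv_N_fderiv_η_comm hp v w
  rw [hv, hw, map_smul, map_smul, smul_apply, smul_apply,
    m.fderiv_fderiv_N_comm hη (fderiv ℝ S.f p w), smul_eq_mul, smul_eq_mul] at h
  rw [m.inner_duInv hη _ (S.fderiv_N_fderiv_f hp w),
    (mul_eq_mul_right_iff.1 h).resolve_left hab, mul_zero]

theorem inner_duInv_self_pos (hadm : m.Admissible) (hp : p ∈ S.U) {v : P2} (hv : v ≠ 0) :
    0 < ⟪m.duInv (S.η p) (fderiv ℝ S.f p v), fderiv ℝ S.f p v⟫_ℝ :=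
  hadm _ (S.unit_η p hp) _ ((map_ne_zero_iff _ (S.immersion p hp)).2 hv)
    (S.fderiv_N_fderiv_f hp v)

end BSurface

/-- If `λ₁ ≥ λ₂` are the principal curvatures of `M` at `p`,
then `λ₂ ≤ k_{M,p}(V) ≤ λ₁` for every nonzero `V ∈ T_pM`; if `λ₁ ≠ λ₂`,
equality on either side holds only in the respective principal direction. -/
theorem normal_curvature_between_principal (m : MinkowskiNorm3)
    (hadm : m.Admissible) (S : BSurface m) (p : P2) (hp : p ∈ S.U)
    (lam₁ lam₂ : ℝ) (hle : lam₂ ≤ lam₁)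
    (v₁ v₂ : P2) (hli : LinearIndependent ℝ ![v₁, v₂])
    (e₁ : fderiv ℝ S.η p v₁ = lam₁ • fderiv ℝ S.f p v₁)
    (e₂ : fderiv ℝ S.η p v₂ = lam₂ • fderiv ℝ S.f p v₂) :
    ∀ v : P2, v ≠ 0 →
      (lam₂ ≤ normalCurv m S.f S.η p v ∧ normalCurv m S.f S.η p v ≤ lam₁) ∧
      (lam₁ ≠ lam₂ →
        ((normalCurv m S.f S.η p v = lam₁ →
            fderiv ℝ S.η p v = lam₁ • fderiv ℝ S.f p v) ∧
         (normalCurv m S.f S.η p v = lam₂ →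
            fderiv ℝ S.η p v = lam₂ • fderiv ℝ S.f p v))) := by
  intro v hv
  have hpos := S.inner_duInv_self_pos hadm hp hv
  obtain ⟨a, b, rfl⟩ : ∃ a b : ℝ, a • v₁ + b • v₂ = v := by
    have hspan := hli.span_eq_top_of_card_eq_finrank (by simp)
    rw [Matrix.range_cons_cons_empty] at hspan
    exact Submodule.mem_span_pair.1 (hspan ▸ Submodule.mem_top)
  have hη : fderiv ℝ S.η p (a • v₁ + b • v₂) =
      a • lam₁ • fderiv ℝ S.f p v₁ + b • lam₂ • fderiv ℝ S.f p v₂ := by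
    rw [map_add, map_smul, map_smul, e₁, e₂]
  rcases eq_or_ne lam₁ lam₂ with rfl | hne
  · have hk : normalCurv m S.f S.η p (a • v₁ + b • v₂) = lam₁ := by
      have : fderiv ℝ S.η p (a • v₁ + b • v₂) = lam₁ • fderiv ℝ S.f p (a • v₁ + b • v₂) := by
        rw [hη, map_add, map_smul, map_smul, smul_add, smul_comm a, smul_comm b]
      rw [normalCurv, this, real_inner_smul_right, mul_div_assoc, div_self hpos.ne', mul_one]
    exact ⟨⟨hk.ge, hk.le⟩, fun h => absurd rfl h⟩
  have h12 := S.inner_duInv_principal_eq_zero hp hne e₁ e₂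
  have h21 := S.inner_duInv_principal_eq_zero hp hne.symm e₂ e₁
  have h11 := S.inner_duInv_self_pos hadm hp (hli.ne_zero 0)
  have h22 := S.inner_duInv_self_pos hadm hp (hli.ne_zero 1)
  simp only [Matrix.cons_val_zero, Matrix.cons_val_one] at h11 h22
  have hlt : lam₂ < lam₁ := lt_of_le_of_ne hle hne.symm
  rw [normalCurv, hη]
  simp only [MinkowskiNorm3.duInv, map_add, map_smul, inner_add_left, inner_add_right,
    real_inner_smul_left, real_inner_smul_right] at h11 h12 h21 h22 hpos ⊢
  rw [h12, h21] at hpos ⊢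
  set A := ⟪fderiv ℝ m.sphereGauss (S.η p) (fderiv ℝ S.f p v₁), fderiv ℝ S.f p v₁⟫_ℝ
  set B := ⟪fderiv ℝ m.sphereGauss (S.η p) (fderiv ℝ S.f p v₂), fderiv ℝ S.f p v₂⟫_ℝ
  have hA : 0 ≤ (lam₁ - lam₂) * (a ^ 2 * A) := by
    have := sub_pos.2 hlt
    positivity
  have hB : 0 ≤ (lam₁ - lam₂) * (b ^ 2 * B) := by
    have := sub_pos.2 hlt
    positivity
  refine ⟨⟨?_, ?_⟩, fun _ => ⟨fun h => ?_, fun h => ?_⟩⟩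
  · rw [le_div_iff₀ hpos]
    linarith
  · rw [div_le_iff₀ hpos]
    linarith
  · rw [div_eq_iff hpos.ne'] at h
    have hb : (lam₁ - lam₂) * (b ^ 2 * B) = 0 := by linarith
    have hb0 : b = 0 := by simpa [sub_ne_zero.2 hne, h22.ne'] using hb
    simp [hb0, smul_comm a lam₁]
  · rw [div_eq_iff hpos.ne'] at h
    have ha : (lam₁ - lam₂) * (a ^ 2 * A) = 0 := by linarith
    have ha0 : a = 0 := by simpa [sub_ne_zero.2 hne, h11.ne'] using ha
    simp [ha0, smul_comm b lam₂]
end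
end

section
/- Let ‖·‖ be an admissible norm on ℝ³ and let f : M → ℝ³ be an immersed surface with Birkhoff normal field η and principal curvature functions λ₁ ≥ λ₂. Let p ∈ M be a point at which the Minkowski Gaussian curvature K(p) = λ₁(p)λ₂(p) is positive, λ₁ has a local maximum, and λ₂ has a local minimum, and suppose that M has coercively convex curvature lines at p. Then p is an umbilic point: λ₁(p) = λ₂(p). -/
/-!
Differential geometry of immersed surfaces in three-dimensional normed
(Minkowski) spaces, following Balestro–Martini–Teixeira.

`E3 = ℝ³` carries its standard Euclidean inner product and, in addition, a
norm `N` which is strictly convex and smooth.  Surfaces are given in a local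
parametrization `f : P2 → E3` (an immersion on an open set `U`), endowed with
a Birkhoff normal field `η`.
-/

noncomputable section

open scoped InnerProductSpace

/-- `M` has coercively convex curvature lines at `p` (for the principal
curvature functions `lam₁ ≥ lam₂`): for every smooth commuting local frame of
principal directions `V₁ = df(W₁), V₂ = df(W₂)` around `p` (with
`dη(Vᵢ) = λᵢ Vᵢ` and `[V₁, V₂] = 0`) and every decomposition
`D_{V₁}V₂ = F V₁ + G V₂`, if `D_{V₁}V₂` vanishes at `p`, then the derivative
of `F` at `p` in the direction `V₂` is negative. -/
def CoercivelyConvexAt (m : MinkowskiNorm3) (S : BSurface m)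
    (lam₁ lam₂ : P2 → ℝ) (p : P2) : Prop :=
  ∀ (O : Set P2), IsOpen O → p ∈ O → O ⊆ S.U →
  ∀ (W₁ W₂ : P2 → P2) (F G : P2 → ℝ),
    ContDiffOn ℝ (⊤ : ℕ∞) W₁ O → ContDiffOn ℝ (⊤ : ℕ∞) W₂ O →
    ContDiffOn ℝ (⊤ : ℕ∞) F O → ContDiffOn ℝ (⊤ : ℕ∞) G O →
    (∀ q ∈ O, W₁ q ≠ 0 ∧ W₂ q ≠ 0) →
    (∀ q ∈ O, fderiv ℝ S.η q (W₁ q) = lam₁ q • fderiv ℝ S.f q (W₁ q)) →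
    (∀ q ∈ O, fderiv ℝ S.η q (W₂ q) = lam₂ q • fderiv ℝ S.f q (W₂ q)) →
    (∀ q ∈ O, fderiv ℝ W₂ q (W₁ q) = fderiv ℝ W₁ q (W₂ q)) →
    (∀ q ∈ O, fderiv ℝ (fun r => fderiv ℝ S.f r (W₂ r)) q (W₁ q) =
        F q • fderiv ℝ S.f q (W₁ q) + G q • fderiv ℝ S.f q (W₂ q)) →
    fderiv ℝ (fun r => fderiv ℝ S.f r (W₂ r)) p (W₁ p) = 0 →
    fderiv ℝ F p (W₂ p) < 0

section LocalTheory

open scoped ContDiff Topology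
open Set Filter

/-- The pointwise application `(A, h) ↦ (s ↦ A s (h s))` as a bounded bilinear map. -/
def pointwiseApply (K : Type*) [TopologicalSpace K] [CompactSpace K] (E F : Type*)
    [NormedAddCommGroup E] [NormedSpace ℝ E] [NormedAddCommGroup F] [NormedSpace ℝ F] :
    C(K, E →L[ℝ] F) →L[ℝ] C(K, E) →L[ℝ] C(K, F) :=
  LinearMap.mkContinuous₂
    (LinearMap.mk₂ ℝ (fun (A : C(K, E →L[ℝ] F)) (h : C(K, E)) =>
        (⟨fun s => A s (h s), by fun_prop⟩ : C(K, F)))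
      (fun _ _ _ => by ext; simp) (fun _ _ _ => by ext; simp)
      (fun _ _ _ => by ext; simp) (fun _ _ _ => by ext; simp)) 1
    (fun A h => by
      rw [one_mul]
      refine (ContinuousMap.norm_le _ (by positivity)).2 fun s => ?_
      exact (A s).le_of_opNorm_le_of_le (A.norm_coe_le_norm s) (h.norm_coe_le_norm s))

@[simp] theorem pointwiseApply_apply {K : Type*} [TopologicalSpace K] [CompactSpace K]
    {E F : Type*} [NormedAddCommGroup E] [NormedSpace ℝ E] [NormedAddCommGroup F]
    [NormedSpace ℝ F] (A : C(K, E →L[ℝ] F)) (h : C(K, E)) (s : K) :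
    pointwiseApply K E F A h s = A s (h s) := rfl

theorem hasFDerivAt_continuousMap_comp {K : Type*} [TopologicalSpace K] [CompactSpace K]
    {E F : Type*} [NormedAddCommGroup E] [NormedSpace ℝ E] [NormedAddCommGroup F]
    [NormedSpace ℝ F] (k : C(E, F)) (k' : C(E, E →L[ℝ] F)) (hk : ∀ x, HasFDerivAt k (k' x) x)
    (w : C(K, E)) :
    HasFDerivAt (fun w : C(K, E) => k.comp w) (pointwiseApply K E F (k'.comp w)) w := by
  rw [hasFDerivAt_iff_isLittleO, Asymptotics.isLittleO_iff]
  intro ε hε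
  have hcont : Continuous fun w : C(K, E) => k'.comp w := k'.continuous_postcomp
  obtain ⟨δ, hδ, hball⟩ := (Metric.continuousAt_iff (f := fun w : C(K, E) => k'.comp w)).1
    (hcont.continuousAt (x := w)) ε hε
  filter_upwards [Metric.ball_mem_nhds w hδ] with v hv
  refine (ContinuousMap.norm_le _ (by positivity)).2 fun s => ?_
  have hs : v s ∈ Metric.ball (w s) δ := by
    rw [Metric.mem_ball] at hv ⊢
    exact (ContinuousMap.dist_apply_le_dist s).trans_lt hv
  have key := (convex_ball (w s) δ).norm_image_sub_le_of_norm_hasFDerivWithin_le'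
    (f := k) (f' := k') (φ := k' (w s)) (C := ε) (fun x _ => (hk x).hasFDerivWithinAt)
    (fun x hx => ?_) (Metric.mem_ball_self hδ) hs
  · refine key.trans ?_
    gcongr
    exact (v - w).norm_coe_le_norm s
  · have hx' : dist (w + ContinuousMap.const K (x - w s)) w < δ := by
      rw [dist_eq_norm, add_sub_cancel_left]
      refine lt_of_le_of_lt ((ContinuousMap.norm_le _ (norm_nonneg _)).2 fun _ => le_rfl) ?_
      rwa [Metric.mem_ball, dist_eq_norm] at hx
    have h1 := (ContinuousMap.dist_apply_le_dist s).trans_lt (hball hx')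
    rw [dist_eq_norm] at h1
    simpa using h1.le

theorem contDiff_continuousMap_comp {K : Type*} [TopologicalSpace K] [CompactSpace K]
    {E F : Type} [NormedAddCommGroup E] [NormedSpace ℝ E] [NormedAddCommGroup F]
    [NormedSpace ℝ F] (k : C(E, F)) (hk : ContDiff ℝ ∞ k) :
    ContDiff ℝ ∞ (fun w : C(K, E) => k.comp w) := by
  rw [contDiff_infty]
  intro n
  induction n generalizing F with
  | zero => exact contDiff_zero.2 k.continuous_postcomp
  | succ n ih =>
    have hk' : ContDiff ℝ ∞ (fderiv ℝ k) := hk.fderiv_right le_rfl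
    refine contDiff_succ_iff_hasFDerivAt.2 ⟨fun w =>
      pointwiseApply K E F ((⟨fderiv ℝ k, hk'.continuous⟩ : C(E, E →L[ℝ] F)).comp w), ?_, ?_⟩
    · exact (pointwiseApply K E F).contDiff.comp (ih ⟨fderiv ℝ k, hk'.continuous⟩ hk')
    · exact hasFDerivAt_continuousMap_comp k ⟨fderiv ℝ k, hk'.continuous⟩
        fun x => (hk.differentiable (by simp) x).hasFDerivAt

theorem exists_openPartialHomeomorph_contDiffOn_symm {E F : Type*} [NormedAddCommGroup E]
    [NormedSpace ℝ E] [CompleteSpace E] [NormedAddCommGroup F] [NormedSpace ℝ F] {f : E → F}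
    {U : Set E} (hU : IsOpen U) (hf : ContDiffOn ℝ ∞ f U) {a : E} (ha : a ∈ U)
    {f' : E ≃L[ℝ] F} (hf' : HasFDerivAt f (f' : E →L[ℝ] F) a) :
    ∃ e : OpenPartialHomeomorph E F, ⇑e = f ∧ a ∈ e.source ∧ e.source ⊆ U ∧
      ContDiffOn ℝ ∞ e.symm e.target := by
  have hfa : ContDiffAt ℝ ∞ f a := hf.contDiffAt (hU.mem_nhds ha)
  have hcont : ContinuousOn (fderiv ℝ f) U := hf.continuousOn_fderiv_of_isOpen hU (by simp)
  set e₀ := hfa.toOpenPartialHomeomorph f hf' (by simp)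
  have hO : IsOpen (U ∩ fderiv ℝ f ⁻¹' range ((↑) : (E ≃L[ℝ] F) → E →L[ℝ] F)) :=
    hcont.isOpen_inter_preimage hU ContinuousLinearEquiv.isOpen
  refine ⟨e₀.restrOpen _ hO, rfl, ⟨hfa.mem_toOpenPartialHomeomorph_source hf' (by simp), ha, ?_⟩,
    fun x hx => hx.2.1, fun y hy => ?_⟩
  · rw [mem_preimage, hf'.fderiv]; exact mem_range_self _
  · have hx := (e₀.restrOpen _ hO).map_target hy
    obtain ⟨f₁, hf₁⟩ := hx.2.2
    have hfx : ContDiffAt ℝ ∞ f ((e₀.restrOpen _ hO).symm y) :=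
      hf.contDiffAt (hU.mem_nhds hx.2.1)
    refine ((e₀.restrOpen _ hO).contDiffAt_symm (f₀' := f₁) hy ?_ hfx).contDiffWithinAt
    rw [hf₁]
    exact (hfx.differentiableAt (by simp)).hasFDerivAt

/-- Constant functions, as a bounded linear map into `C(K, E)`. -/
def constantCLM (K : Type*) [TopologicalSpace K] [CompactSpace K] (E : Type*)
    [NormedAddCommGroup E] [NormedSpace ℝ E] : E →L[ℝ] C(K, E) :=
  LinearMap.mkContinuous ⟨⟨ContinuousMap.const K, fun _ _ => rfl⟩, fun _ _ => rfl⟩ 1 fun c => by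
    rw [one_mul]
    exact (ContinuousMap.norm_le _ (norm_nonneg _)).2 fun _ => le_rfl

@[simp] theorem constantCLM_apply {K : Type*} [TopologicalSpace K] [CompactSpace K] {E : Type*}
    [NormedAddCommGroup E] [NormedSpace ℝ E] (c : E) (s : K) : constantCLM K E c s = c := rfl

/-- The extension of a function on `[-1, 1]` to the real line by its boundary values. -/
def extendReal {E : Type*} (w : Icc (-1 : ℝ) 1 → E) : ℝ → E :=
  IccExtend (by norm_num : (-1 : ℝ) ≤ 1) w

theorem continuous_extendReal {E : Type*} [TopologicalSpace E] (w : C(Icc (-1 : ℝ) 1, E)) :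
    Continuous (extendReal w) := w.continuous.Icc_extend'

theorem extendReal_of_mem {E : Type*} (w : Icc (-1 : ℝ) 1 → E) {t : ℝ} (ht : t ∈ Icc (-1 : ℝ) 1) :
    extendReal w t = w ⟨t, ht⟩ := IccExtend_of_mem _ _ ht

/-- The integration operator `w ↦ (t ↦ ∫ s in 0..t, w s)` on `C([-1, 1], E)`. -/
def integralFromZero (E : Type*) [NormedAddCommGroup E] [NormedSpace ℝ E] :
    C(Icc (-1 : ℝ) 1, E) →L[ℝ] C(Icc (-1 : ℝ) 1, E) :=
  LinearMap.mkContinuous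
    { toFun := fun w => ⟨fun t => ∫ s in (0 : ℝ)..t, extendReal w s,
        (intervalIntegral.continuous_primitive
          (fun a b => (continuous_extendReal w).intervalIntegrable a b) 0).comp
            continuous_subtype_val⟩
      map_add' := fun v w => by
        ext t
        exact intervalIntegral.integral_add ((continuous_extendReal v).intervalIntegrable _ _)
          ((continuous_extendReal w).intervalIntegrable _ _)
      map_smul' := fun c w => by
        ext t
        exact intervalIntegral.integral_smul c _ } 1
    (fun w => by
      rw [one_mul]
      refine (ContinuousMap.norm_le _ (norm_nonneg _)).2 fun t => ?_
      refine (intervalIntegral.norm_integral_le_of_norm_le_const (C := ‖w‖)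
        fun s _ => w.norm_coe_le_norm _).trans ?_
      rw [sub_zero]
      exact mul_le_of_le_one_right (norm_nonneg _) (abs_le.2 t.2))

theorem integralFromZero_apply {E : Type*} [NormedAddCommGroup E] [NormedSpace ℝ E]
    (w : C(Icc (-1 : ℝ) 1, E)) (t : Icc (-1 : ℝ) 1) :
    integralFromZero E w t = ∫ s in (0 : ℝ)..t, extendReal w s := rfl

/-- The curve `t ↦ z (r t)`. -/
def rescale {E : Type*} [TopologicalSpace E] (z : C(Icc (-1 : ℝ) 1, E)) (r : ℝ) :
    C(Icc (-1 : ℝ) 1, E) :=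
  ⟨fun t => extendReal z (r * t),
    (continuous_extendReal z).comp (continuous_const.mul continuous_subtype_val)⟩

theorem mul_mem_Icc_neg_one_one {r t : ℝ} (hr : r ∈ Icc (-1 : ℝ) 1) (ht : t ∈ Icc (-1 : ℝ) 1) :
    r * t ∈ Icc (-1 : ℝ) 1 := by
  rw [mem_Icc, ← abs_le] at *
  rw [abs_mul]
  exact mul_le_one₀ hr (abs_nonneg _) ht

theorem extendReal_comp {E F : Type*} (X : E → F) (w : Icc (-1 : ℝ) 1 → E) (t : ℝ) :
    extendReal (X ∘ w) t = X (extendReal w t) := rfl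

theorem integralFromZero_comp_rescale {E : Type*} [NormedAddCommGroup E] [NormedSpace ℝ E]
    (X : C(E, E)) (z : C(Icc (-1 : ℝ) 1, E)) {r : ℝ} (hr : r ∈ Icc (-1 : ℝ) 1)
    (t : Icc (-1 : ℝ) 1) :
    r • integralFromZero E (X.comp (rescale z r)) t =
      integralFromZero E (X.comp z) ⟨r * t, mul_mem_Icc_neg_one_one hr t.2⟩ := by
  rw [integralFromZero_apply, integralFromZero_apply]
  have hcongr : ∫ s in (0 : ℝ)..t, extendReal (X.comp (rescale z r)) s =
      ∫ s in (0 : ℝ)..t, extendReal (X.comp z) (r * s) := by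
    refine intervalIntegral.integral_congr fun s hs => ?_
    have hs' : s ∈ Icc (-1 : ℝ) 1 :=
      (uIcc_subset_Icc (by norm_num : (0 : ℝ) ∈ Icc (-1 : ℝ) 1) t.2) hs
    simp only [ContinuousMap.coe_comp, extendReal_comp]
    rw [extendReal_of_mem _ hs']
    rfl
  rw [hcongr, intervalIntegral.smul_integral_comp_mul_left]
  simp

/-- A smooth vector field on a Banach space has a smooth local flow. -/
theorem exists_contDiffOn_flow {E : Type} [NormedAddCommGroup E] [NormedSpace ℝ E]
    [CompleteSpace E] {X : E → E} (hX : ContDiff ℝ ∞ X) (c₀ : E) :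
    ∃ (φ : ℝ × E → E) (V : Set (ℝ × E)), IsOpen V ∧ (0, c₀) ∈ V ∧ ContDiffOn ℝ ∞ φ V ∧
      (∀ c, (0, c) ∈ V → φ (0, c) = c) ∧
      ∀ q ∈ V, HasDerivAt (fun x => φ (x, q.2)) (X (φ q)) q.1 := by
  let T := Icc (-1 : ℝ) 1
  let XC : C(E, E) := ⟨X, hX.continuous⟩
  let J : C(T, E) → C(T, E) := fun z => integralFromZero E (XC.comp z)
  have hJ : ContDiff ℝ ∞ J :=
    (integralFromZero E).contDiff.comp (contDiff_continuousMap_comp XC hX)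
  let Θ : ℝ × E × C(T, E) → ℝ × E × C(T, E) :=
    fun q => (q.1, q.2.1, q.2.2 - constantCLM T E q.2.1 - q.1 • J q.2.2)
  have hΘ : ContDiff ℝ ∞ Θ := by
    refine contDiff_fst.prodMk (contDiff_snd.fst.prodMk ?_)
    exact (contDiff_snd.snd.sub ((constantCLM T E).contDiff.comp contDiff_snd.fst)).sub
      (contDiff_fst.smul (hJ.comp contDiff_snd.snd))
  let z₀ : C(T, E) := constantCLM T E c₀
  let a : ℝ × E × C(T, E) := (0, c₀, z₀)
  let π₁ : ℝ × E × C(T, E) →L[ℝ] ℝ := .fst ℝ ℝ (E × C(T, E))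
  let π₂ : ℝ × E × C(T, E) →L[ℝ] E := (.fst ℝ E C(T, E)) ∘L .snd ℝ ℝ (E × C(T, E))
  let π₃ : ℝ × E × C(T, E) →L[ℝ] C(T, E) := (.snd ℝ E C(T, E)) ∘L .snd ℝ ℝ (E × C(T, E))
  let Θ' : (ℝ × E × C(T, E)) ≃L[ℝ] (ℝ × E × C(T, E)) := .equivOfInverse
    (π₁.prod (π₂.prod (π₃ - constantCLM T E ∘L π₂ - π₁.smulRight (J z₀))))
    (π₁.prod (π₂.prod (π₃ + constantCLM T E ∘L π₂ + π₁.smulRight (J z₀))))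
    (fun q => Prod.ext rfl (Prod.ext rfl (by
      change q.2.2 - constantCLM T E q.2.1 - q.1 • J z₀ + constantCLM T E q.2.1 + q.1 • J z₀ = q.2.2
      abel)))
    (fun q => Prod.ext rfl (Prod.ext rfl (by
      change q.2.2 + constantCLM T E q.2.1 + q.1 • J z₀ - constantCLM T E q.2.1 - q.1 • J z₀ = q.2.2
      abel)))
  have hΘ' : HasFDerivAt Θ (Θ' : ℝ × E × C(T, E) →L[ℝ] ℝ × E × C(T, E)) a := by
    have h₁ : HasFDerivAt (fun q : ℝ × E × C(T, E) => q.1) π₁ a := π₁.hasFDerivAt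
    have h₂ : HasFDerivAt (fun q : ℝ × E × C(T, E) => q.2.1) π₂ a := π₂.hasFDerivAt
    have h₃ : HasFDerivAt (fun q : ℝ × E × C(T, E) => q.2.2) π₃ a := π₃.hasFDerivAt
    have h₄ : HasFDerivAt (fun q : ℝ × E × C(T, E) => J q.2.2) (fderiv ℝ J z₀ ∘L π₃) a :=
      HasFDerivAt.comp (g := J) a (hJ.differentiable (by simp) z₀).hasFDerivAt h₃
    have h₅ := h₁.prodMk (h₂.prodMk
      ((h₃.sub ((constantCLM T E).hasFDerivAt.comp a h₂)).sub (h₁.smul h₄)))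
    refine h₅.congr_fderiv ?_
    ext q <;> simp [Θ', π₁, π₂, π₃, a]
  obtain ⟨e, he, hae, -, hsymm⟩ :=
    exists_openPartialHomeomorph_contDiffOn_symm isOpen_univ hΘ.contDiffOn (mem_univ a) hΘ'
  have hΘa : e a = (0, c₀, 0) := by
    rw [he]; simp [Θ, a, z₀]
  have htgt : e.target ∈ 𝓝 ((0, c₀, 0) : ℝ × E × C(T, E)) := by
    rw [← hΘa]; exact e.open_target.mem_nhds (e.map_source hae)
  obtain ⟨δ, hδ, hball⟩ := Metric.isOpen_iff.1 e.open_source a hae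
  let ι : ℝ × E → ℝ × E × C(T, E) := fun q => (q.1, q.2, 0)
  have hι : ContDiff ℝ ∞ ι := contDiff_fst.prodMk (contDiff_snd.prodMk contDiff_const)
  have hev : ∀ᶠ q in 𝓝 ((0, c₀) : ℝ × E), ι q ∈ e.target ∧
      e.symm (ι q) ∈ Metric.ball a δ := by
    have h1 : ∀ᶠ q in 𝓝 ((0, c₀) : ℝ × E), ι q ∈ e.target :=
      (hι.continuous.continuousAt (x := (0, c₀))).eventually htgt
    have h2 : ContinuousAt (fun q => e.symm (ι q)) (0, c₀) := by
      refine ContinuousAt.comp (g := e.symm) ?_ hι.continuous.continuousAt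
      exact e.symm.continuousAt (mem_of_mem_nhds htgt)
    have h3 : e.symm (ι (0, c₀)) = a := by
      change e.symm (0, c₀, 0) = a
      rw [← hΘa, e.left_inv hae]
    refine h1.and (h2.eventually ?_)
    change Metric.ball a δ ∈ 𝓝 (e.symm (ι (0, c₀)))
    rw [h3]
    exact Metric.ball_mem_nhds a hδ
  obtain ⟨σ, hσ, hσball⟩ := Metric.eventually_nhds_iff_ball.1 hev
  let Z : ℝ × E → C(T, E) := fun q => (e.symm (ι q)).2.2
  have hsol : ∀ q ∈ Metric.ball ((0, c₀) : ℝ × E) σ, e.symm (ι q) = (q.1, q.2, Z q) ∧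
      Z q = constantCLM T E q.2 + q.1 • J (Z q) := by
    intro q hq
    have h := e.right_inv (hσball q hq).1
    rw [he] at h
    have h1 : (e.symm (ι q)).1 = q.1 := congrArg (fun p => p.1) h
    have h2 : (e.symm (ι q)).2.1 = q.2 := congrArg (fun p => p.2.1) h
    have h3 := congrArg (fun p => p.2.2) h
    simp only [Θ, ι] at h3
    refine ⟨Prod.ext h1 (Prod.ext h2 rfl), ?_⟩
    change (e.symm (ι q)).2.2 - constantCLM T E (e.symm (ι q)).2.1 -
      (e.symm (ι q)).1 • J (e.symm (ι q)).2.2 = 0 at h3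
    rw [h1, h2, sub_sub, sub_eq_zero] at h3
    exact h3
  let one : T := ⟨1, by simp [T]⟩
  let ρ := min (σ / 2) (δ / 2)
  have hρ : 0 < ρ := by positivity
  have hρσ : ρ < σ := (min_le_left _ _).trans_lt (half_lt_self hσ)
  have hρδ : ρ < δ := (min_le_right _ _).trans_lt (half_lt_self hδ)
  have hmem : ∀ c ∈ Metric.ball c₀ ρ, ((ρ, c) : ℝ × E) ∈ Metric.ball ((0, c₀) : ℝ × E) σ := by
    intro c hc
    rw [Metric.mem_ball] at hc ⊢
    rw [Prod.dist_eq, max_lt_iff]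
    refine ⟨?_, hc.trans hρσ⟩
    simpa [abs_of_pos hρ] using hρσ
  have hresc : ∀ x ∈ Metric.ball (0 : ℝ) ρ, ∀ c ∈ Metric.ball c₀ ρ,
      Z (x, c) one = extendReal (Z (ρ, c)) (x / ρ) := by
    intro x hx c hc
    have hr : x / ρ ∈ Icc (-1 : ℝ) 1 := by
      rw [mem_Icc, ← abs_le, abs_div, abs_of_pos hρ, div_le_one hρ]
      simpa using (Metric.mem_ball.1 hx).le
    set r := x / ρ with hr_def
    have hxr : x = ρ * r := by rw [hr_def]; field_simp
    obtain ⟨hs1, hs2⟩ := hsol _ (hmem c hc)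
    have hZb := (hσball _ (hmem c hc)).2
    rw [hs1, Metric.mem_ball, Prod.dist_eq, max_lt_iff, Prod.dist_eq, max_lt_iff] at hZb
    have hin : ((x, c, rescale (Z (ρ, c)) r) : ℝ × E × C(T, E)) ∈ e.source := by
      apply hball
      rw [Metric.mem_ball, Prod.dist_eq, max_lt_iff, Prod.dist_eq, max_lt_iff]
      refine ⟨(Metric.mem_ball.1 hx).trans hρδ, (Metric.mem_ball.1 hc).trans hρδ, ?_⟩
      refine lt_of_le_of_lt ((ContinuousMap.dist_le dist_nonneg).2 fun t => ?_) hZb.2.2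
      exact ContinuousMap.dist_apply_le_dist (f := Z (ρ, c)) (g := z₀) _
    have hxc : ((x, c) : ℝ × E) ∈ Metric.ball ((0, c₀) : ℝ × E) σ := by
      rw [Metric.mem_ball, Prod.dist_eq, max_lt_iff]
      exact ⟨(Metric.mem_ball.1 hx).trans hρσ, (Metric.mem_ball.1 hc).trans hρσ⟩
    have heq : e (x, c, rescale (Z (ρ, c)) r) = ι (x, c) := by
      rw [he]
      refine Prod.ext rfl (Prod.ext rfl ?_)
      change rescale (Z (ρ, c)) r - constantCLM T E c - x • J (rescale (Z (ρ, c)) r) = 0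
      ext t
      have h4 := DFunLike.congr_fun hs2 ⟨r * t, mul_mem_Icc_neg_one_one hr t.2⟩
      have h5 := integralFromZero_comp_rescale XC (Z (ρ, c)) hr t
      have h6 : rescale (Z (ρ, c)) r t = Z (ρ, c) ⟨r * t, mul_mem_Icc_neg_one_one hr t.2⟩ :=
        extendReal_of_mem _ _
      have h7 : x • J (rescale (Z (ρ, c)) r) t =
          ρ • J (Z (ρ, c)) ⟨r * t, mul_mem_Icc_neg_one_one hr t.2⟩ := by
        rw [hxr, mul_smul]; exact congrArg (ρ • ·) h5
      simp only [ContinuousMap.sub_apply, ContinuousMap.smul_apply, ContinuousMap.zero_apply,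
        ContinuousMap.add_apply, constantCLM_apply] at h4 ⊢
      rw [h7, h6, h4]
      change c + _ - c - _ = (0 : E)
      abel
    have h8 : e.symm (ι (x, c)) = (x, c, rescale (Z (ρ, c)) r) := by
      rw [← heq, e.left_inv hin]
    have h9 : Z (x, c) = rescale (Z (ρ, c)) r := congrArg (fun p => p.2.2) h8
    rw [h9]
    change extendReal (Z (ρ, c)) (r * 1) = _
    rw [mul_one]
  refine ⟨fun q => Z q one, Metric.ball 0 ρ ×ˢ Metric.ball c₀ ρ,
    Metric.isOpen_ball.prod Metric.isOpen_ball,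
    ⟨Metric.mem_ball_self hρ, Metric.mem_ball_self hρ⟩, ?_, ?_, ?_⟩
  · have h1 : ContDiffOn ℝ ∞ (fun q => e.symm (ι q)) (Metric.ball 0 ρ ×ˢ Metric.ball c₀ ρ) := by
      refine hsymm.comp hι.contDiffOn fun q hq => (hσball q ?_).1
      rw [Metric.mem_ball, Prod.dist_eq, max_lt_iff]
      exact ⟨(Metric.mem_ball.1 hq.1).trans hρσ, (Metric.mem_ball.1 hq.2).trans hρσ⟩
    exact ((ContinuousMap.evalCLM ℝ one).contDiff.comp π₃.contDiff).comp_contDiffOn h1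
  · intro c hc
    have h1 := DFunLike.congr_fun (hsol _ (hmem c hc.2)).2 ⟨0, by simp [T]⟩
    have h2 := hresc 0 hc.1 c hc.2
    change Z (0, c) one = c
    have h3 : J (Z (ρ, c)) ⟨0, by simp [T]⟩ = 0 := intervalIntegral.integral_same
    rw [h2, zero_div, extendReal_of_mem _ (by norm_num), h1, ContinuousMap.add_apply,
      ContinuousMap.smul_apply, h3, smul_zero, add_zero, constantCLM_apply]
  · rintro ⟨x, c⟩ ⟨hx, hc⟩
    have hev : (fun y => Z (y, c) one) =ᶠ[𝓝 x]
        fun y => c + ρ • ∫ s in (0 : ℝ)..(y / ρ), extendReal (XC.comp (Z (ρ, c))) s := by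
      filter_upwards [Metric.isOpen_ball.mem_nhds hx] with y hy
      have hr : y / ρ ∈ Icc (-1 : ℝ) 1 := by
        rw [mem_Icc, ← abs_le, abs_div, abs_of_pos hρ, div_le_one hρ]
        simpa using (Metric.mem_ball.1 hy).le
      have h1 := DFunLike.congr_fun (hsol _ (hmem c hc)).2 ⟨y / ρ, hr⟩
      rw [hresc y hy c hc, extendReal_of_mem _ hr, h1]
      rfl
    refine HasDerivAt.congr_of_eventuallyEq ?_ hev
    have hcont := continuous_extendReal (XC.comp (Z (ρ, c)))
    have h1 : HasDerivAt (fun u => ∫ s in (0 : ℝ)..u, extendReal (XC.comp (Z (ρ, c))) s)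
        (extendReal (XC.comp (Z (ρ, c))) (x / ρ)) (x / ρ) :=
      hcont.integral_hasStrictDerivAt 0 (x / ρ) |>.hasDerivAt
    have h2 := ((h1.scomp x ((hasDerivAt_id x).div_const ρ)).const_smul ρ).const_add c
    refine h2.congr_deriv ?_
    rw [smul_smul, mul_one_div_cancel hρ.ne', one_smul]
    change X (extendReal (Z (ρ, c)) (x / ρ)) = X (Z (x, c) one)
    rw [hresc x hx c hc]

/-- A smooth function on an open set agrees near each point with a globally smooth one. -/
theorem exists_contDiff_eqOn_ball {E F : Type*} [NormedAddCommGroup E] [NormedSpace ℝ E]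
    [HasContDiffBump E] [FiniteDimensional ℝ E] [NormedAddCommGroup F] [NormedSpace ℝ F]
    {X : E → F} {O : Set E} (hO : IsOpen O) (hX : ContDiffOn ℝ ∞ X O) {p : E} (hp : p ∈ O) :
    ∃ Y : E → F, ContDiff ℝ ∞ Y ∧ ∃ r > 0, EqOn Y X (Metric.ball p r) := by
  obtain ⟨ε, hε, hball⟩ := Metric.isOpen_iff.1 hO p hp
  let χ : ContDiffBump p := ⟨ε / 4, ε / 2, by linarith, by linarith⟩
  refine ⟨fun q => χ q • X q, contDiff_iff_contDiffAt.2 fun q => ?_, ε / 4, by linarith,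
    fun q hq => ?_⟩
  · by_cases hq : q ∈ O
    · exact χ.contDiff.contDiffAt.smul (hX.contDiffAt (hO.mem_nhds hq))
    · have h : q ∉ tsupport χ := by
        rw [χ.tsupport_eq]
        exact fun h => hq (hball (Metric.closedBall_subset_ball (half_lt_self hε) h))
      refine contDiffAt_const (c := (0 : F)) |>.congr_of_eventuallyEq ?_
      filter_upwards [notMem_tsupport_iff_eventuallyEq.1 h] with r hr
      rw [hr, Pi.zero_apply, zero_smul]
  · change χ q • X q = X q
    rw [χ.one_of_mem_closedBall (Metric.ball_subset_closedBall hq), one_smul]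

/-- Local existence of a first integral of `X` which is not stationary along `Y`. -/
theorem exists_first_integral {X Y : P2 → P2} {O : Set P2} (hO : IsOpen O) {p : P2} (hp : p ∈ O)
    (hX : ContDiffOn ℝ ∞ X O) (hY : ContDiffOn ℝ ∞ Y O)
    (hXY : LinearIndependent ℝ ![X p, Y p]) :
    ∃ (u : P2 → ℝ) (O' : Set P2), IsOpen O' ∧ p ∈ O' ∧ O' ⊆ O ∧ ContDiffOn ℝ ∞ u O' ∧
      (∀ q ∈ O', fderiv ℝ u q (X q) = 0) ∧ ∀ q ∈ O', fderiv ℝ u q (Y q) ≠ 0 := by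
  obtain ⟨X', hX', r, hr, hXX'⟩ := exists_contDiff_eqOn_ball hO hX hp
  obtain ⟨φ, V, hV, hpV, hφ, hφ0, hφX⟩ := exists_contDiffOn_flow hX' p
  set w := Y p with hw
  let ι : ℝ × ℝ → ℝ × P2 := fun z => (z.1, p + z.2 • w)
  have hι : ContDiff ℝ ∞ ι :=
    contDiff_fst.prodMk (contDiff_const.add (contDiff_snd.smul contDiff_const))
  have hι0 : ι 0 = (0, p) := by simp [ι]
  let Ψ : ℝ × ℝ → P2 := fun z => φ (ι z)
  have hV' : IsOpen (ι ⁻¹' V) := hV.preimage hι.continuous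
  have h0V' : (0 : ℝ × ℝ) ∈ ι ⁻¹' V := by rw [mem_preimage, hι0]; exact hpV
  have hΨ : ContDiffOn ℝ ∞ Ψ (ι ⁻¹' V) := hφ.comp hι.contDiffOn fun _ h => h
  have hΨ1 : ∀ z ∈ ι ⁻¹' V, HasDerivAt (fun x => Ψ (x, z.2)) (X' (Ψ z)) z.1 := fun z hz =>
    hφX _ hz
  have hΨ2 : ∀ s : ℝ, (0, s) ∈ ι ⁻¹' V → Ψ (0, s) = p + s • w := fun s hs => hφ0 _ hs
  have hΨd : DifferentiableAt ℝ Ψ 0 :=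
    (hΨ.contDiffAt (hV'.mem_nhds h0V')).differentiableAt (by simp)
  have hΨ0 : Ψ 0 = p := (hΨ2 0 h0V').trans (by simp)
  have hd1 : fderiv ℝ Ψ 0 (1, 0) = X p := by
    have h1 : HasDerivAt (fun x : ℝ => (x, (0 : ℝ))) (1, 0) 0 :=
      (hasDerivAt_id 0).prodMk (hasDerivAt_const _ _)
    have h2 := HasFDerivAt.comp_hasDerivAt (l := Ψ) (f := fun x : ℝ => (x, (0 : ℝ))) 0
      hΨd.hasFDerivAt h1
    have h3 := h2.unique (hΨ1 0 h0V')
    rw [h3, hΨ0, hXX' (Metric.mem_ball_self hr)]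
  have hd2 : fderiv ℝ Ψ 0 (0, 1) = w := by
    have h1 : HasDerivAt (fun s : ℝ => ((0 : ℝ), s)) (0, 1) 0 :=
      (hasDerivAt_const _ _).prodMk (hasDerivAt_id 0)
    have h2 := HasFDerivAt.comp_hasDerivAt (l := Ψ) (f := fun s : ℝ => ((0 : ℝ), s)) 0
      hΨd.hasFDerivAt h1
    have h3 : HasDerivAt (fun s : ℝ => p + s • w) w 0 := by
      simpa using ((hasDerivAt_id (0 : ℝ)).smul_const w).const_add p
    refine h2.unique (h3.congr_of_eventuallyEq ?_)
    have h4 : ContinuousAt (fun s : ℝ => ((0 : ℝ), s)) 0 := h1.continuousAt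
    filter_upwards [h4.eventually (hV'.mem_nhds h0V')] with s hs using hΨ2 s hs
  have hinj : Function.Injective (fderiv ℝ Ψ 0 : ℝ × ℝ →ₗ[ℝ] P2) := by
    rw [injective_iff_map_eq_zero]
    rintro ⟨x, s⟩ h
    have h1 : ((x, s) : ℝ × ℝ) = x • (1, 0) + s • (0, 1) := by simp
    rw [ContinuousLinearMap.coe_coe, h1, map_add, map_smul, map_smul, hd1, hd2] at h
    obtain ⟨h2, h3⟩ := LinearIndependent.pair_iff.1 hXY x s h
    rw [h2, h3]; rfl
  let D : (ℝ × ℝ) ≃L[ℝ] P2 :=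
    (LinearMap.linearEquivOfInjective _ hinj (by simp)).toContinuousLinearEquiv
  have hD : HasFDerivAt Ψ (D : ℝ × ℝ →L[ℝ] P2) 0 := by
    refine hΨd.hasFDerivAt.congr_fderiv ?_
    ext z <;> rfl
  obtain ⟨e, he, h0e, heV, hsymm⟩ :=
    exists_openPartialHomeomorph_contDiffOn_symm hV' hΨ h0V' hD
  have hep : e 0 = p := by rw [he, hΨ0]
  have hpt : p ∈ e.target := hep ▸ e.map_source h0e
  let u : P2 → ℝ := fun q => (e.symm q).2
  have hu : ContDiffOn ℝ ∞ u e.target := contDiff_snd.comp_contDiffOn hsymm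
  have hud : ∀ q ∈ e.target, DifferentiableAt ℝ u q := fun q hq =>
    (hu.contDiffAt (e.open_target.mem_nhds hq)).differentiableAt (by simp)
  have huΨ : ∀ z ∈ e.source, u (Ψ z) = z.2 := by
    intro z hz
    change (e.symm (Ψ z)).2 = z.2
    rw [← he, e.left_inv hz]
  have huX : ∀ q ∈ e.target, fderiv ℝ u q (X' q) = 0 := by
    intro q hq
    set z := e.symm q with hz
    have hzs : z ∈ e.source := e.map_target hq
    have hzq : Ψ z = q := by rw [← he, hz, e.right_inv hq]
    have h1 := hΨ1 z (heV hzs)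
    have h2 := HasFDerivAt.comp_hasDerivAt (l := u) z.1
      (by change HasFDerivAt u (fderiv ℝ u (Ψ z)) (Ψ z); rw [hzq]; exact (hud q hq).hasFDerivAt) h1
    rw [hzq] at h2
    refine h2.unique ((hasDerivAt_const z.1 z.2).congr_of_eventuallyEq ?_)
    have h4 : ContinuousAt (fun x : ℝ => (x, z.2)) z.1 := by fun_prop
    filter_upwards [h4.eventually (e.open_source.mem_nhds hzs)] with x hx using huΨ _ hx
  have huw : fderiv ℝ u p w = 1 := by
    have h3 : HasDerivAt (fun s : ℝ => p + s • w) w 0 := by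
      simpa using ((hasDerivAt_id (0 : ℝ)).smul_const w).const_add p
    have h2 := HasFDerivAt.comp_hasDerivAt (l := u) (0 : ℝ)
      (by simpa using (hud p hpt).hasFDerivAt) h3
    refine h2.unique ((hasDerivAt_id (0 : ℝ)).congr_of_eventuallyEq ?_)
    have h4 : ContinuousAt (fun s : ℝ => ((0 : ℝ), s)) 0 := by fun_prop
    filter_upwards [h4.eventually (e.open_source.mem_nhds h0e)] with s hs
    change u (p + s • w) = s
    rw [← hΨ2 s (heV hs), huΨ _ hs]
  have hA : IsOpen (e.target ∩ Metric.ball p r ∩ O) :=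
    (e.open_target.inter Metric.isOpen_ball).inter hO
  have hcont : ContinuousOn (fun q => fderiv ℝ u q (Y q)) (e.target ∩ Metric.ball p r ∩ O) :=
    ((hu.continuousOn_fderiv_of_isOpen e.open_target (by simp)).mono
      (inter_subset_left.trans inter_subset_left)).clm_apply (hY.continuousOn.mono inter_subset_right)
  refine ⟨u, _, hcont.isOpen_inter_preimage hA isOpen_compl_singleton (t := {0}ᶜ),
    ⟨⟨⟨hpt, Metric.mem_ball_self hr⟩, hp⟩, ?_⟩, fun q hq => hq.1.2,
    hu.mono fun q hq => hq.1.1.1, fun q hq => ?_, fun q hq => hq.2⟩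
  · change fderiv ℝ u p w ≠ 0
    rw [huw]; exact one_ne_zero
  · rw [← hXX' hq.1.1.2]
    exact huX q hq.1.1.1

section SecondDerivative

variable {E F : Type*} [NormedAddCommGroup E] [NormedSpace ℝ E] [NormedAddCommGroup F]
  [NormedSpace ℝ F]

theorem fderiv_fderiv_apply {g : E → F} {W : E → E} {O : Set E} (hO : IsOpen O)
    (hg : ContDiffOn ℝ ∞ g O) (hW : ContDiffOn ℝ ∞ W O) {q : E} (hq : q ∈ O) (w : E) :
    fderiv ℝ (fun r => fderiv ℝ g r (W r)) q w =
      fderiv ℝ (fderiv ℝ g) q w (W q) + fderiv ℝ g q (fderiv ℝ W q w) := by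
  have h1 : DifferentiableAt ℝ (fderiv ℝ g) q :=
    ((hg.fderiv_of_isOpen (m := 1) hO (by norm_cast)).contDiffAt (hO.mem_nhds hq)).differentiableAt
      (by simp)
  have h2 : DifferentiableAt ℝ W q :=
    (hW.contDiffAt (hO.mem_nhds hq)).differentiableAt (by simp)
  rw [(h1.hasFDerivAt.clm_apply h2.hasFDerivAt).fderiv]
  simp [add_comm]

/-- `X (Y g) - Y (X g) = [X, Y] g`. -/
theorem fderiv_fderiv_apply_sub {g : E → F} {X Y : E → E} {O : Set E} (hO : IsOpen O)
    (hg : ContDiffOn ℝ ∞ g O) (hX : ContDiffOn ℝ ∞ X O) (hY : ContDiffOn ℝ ∞ Y O) {q : E}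
    (hq : q ∈ O) :
    fderiv ℝ (fun r => fderiv ℝ g r (Y r)) q (X q) -
      fderiv ℝ (fun r => fderiv ℝ g r (X r)) q (Y q) =
      fderiv ℝ g q (fderiv ℝ Y q (X q) - fderiv ℝ X q (Y q)) := by
  have h : IsSymmSndFDerivAt ℝ g q :=
    (hg.contDiffAt (hO.mem_nhds hq)).isSymmSndFDerivAt (by
      rw [minSmoothness_of_isRCLikeNormedField]; exact WithTop.coe_le_coe.2 le_top)
  rw [fderiv_fderiv_apply hO hg hX hq, fderiv_fderiv_apply hO hg hY hq, h (X q) (Y q), map_sub]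
  abel

end SecondDerivative

/-- Two transverse line fields on a surface are spanned by commuting vector fields. -/
theorem exists_commuting_frame {X Y : P2 → P2} {O : Set P2} (hO : IsOpen O) {p : P2} (hp : p ∈ O)
    (hX : ContDiffOn ℝ ∞ X O) (hY : ContDiffOn ℝ ∞ Y O)
    (hXY : LinearIndependent ℝ ![X p, Y p]) :
    ∃ (a b : P2 → ℝ) (O' : Set P2), IsOpen O' ∧ p ∈ O' ∧ O' ⊆ O ∧
      ContDiffOn ℝ ∞ (fun q => a q • X q) O' ∧ ContDiffOn ℝ ∞ (fun q => b q • Y q) O' ∧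
      (∀ q ∈ O', a q • X q ≠ 0 ∧ b q • Y q ≠ 0) ∧
      ∀ q ∈ O', fderiv ℝ (fun r => b r • Y r) q (a q • X q) =
        fderiv ℝ (fun r => a r • X r) q (b q • Y q) := by
  obtain ⟨v, O₁, hO₁, hp₁, hO₁O, hv, hvX, hvY⟩ := exists_first_integral hO hp hX hY hXY
  obtain ⟨u, O₂, hO₂, hp₂, hO₂O, hu, huY, huX⟩ :=
    exists_first_integral hO hp hY hX (LinearIndependent.pair_symm_iff.1 hXY)
  set O' := O₁ ∩ O₂ with hO'_def
  have hO' : IsOpen O' := hO₁.inter hO₂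
  have hO'O : O' ⊆ O := inter_subset_left.trans hO₁O
  replace hu := hu.mono (inter_subset_right : O' ⊆ O₂)
  replace hv := hv.mono (inter_subset_left : O' ⊆ O₁)
  replace hX := hX.mono hO'O
  replace hY := hY.mono hO'O
  have hW₁ : ContDiffOn ℝ ∞ (fun q => (fderiv ℝ u q (X q))⁻¹ • X q) O' :=
    (((hu.fderiv_of_isOpen hO' (by simp)).clm_apply hX).inv fun q hq => huX q hq.2).smul hX
  have hW₂ : ContDiffOn ℝ ∞ (fun q => (fderiv ℝ v q (Y q))⁻¹ • Y q) O' :=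
    (((hv.fderiv_of_isOpen hO' (by simp)).clm_apply hY).inv fun q hq => hvY q hq.1).smul hY
  have key : ∀ (g : P2 → ℝ) (c d : ℝ) (A B : P2 → P2), ContDiffOn ℝ ∞ g O' →
      ContDiffOn ℝ ∞ A O' → ContDiffOn ℝ ∞ B O' → (∀ q ∈ O', fderiv ℝ g q (A q) = c) →
      (∀ q ∈ O', fderiv ℝ g q (B q) = d) → ∀ q ∈ O',
      fderiv ℝ g q (fderiv ℝ B q (A q) - fderiv ℝ A q (B q)) = 0 := by
    intro g c d A B hg hA hB hgA hgB q hq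
    rw [← fderiv_fderiv_apply_sub hO' hg hA hB hq]
    have h1 : (fun r => fderiv ℝ g r (A r)) =ᶠ[𝓝 q] fun _ => c := by
      filter_upwards [hO'.mem_nhds hq] with r hr using hgA r hr
    have h2 : (fun r => fderiv ℝ g r (B r)) =ᶠ[𝓝 q] fun _ => d := by
      filter_upwards [hO'.mem_nhds hq] with r hr using hgB r hr
    rw [h1.fderiv_eq, h2.fderiv_eq]
    simp
  refine ⟨fun q => (fderiv ℝ u q (X q))⁻¹, fun q => (fderiv ℝ v q (Y q))⁻¹, O', hO', ⟨hp₁, hp₂⟩,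
    hO'O, hW₁, hW₂, fun q hq => ⟨?_, ?_⟩, fun q hq => ?_⟩
  · refine smul_ne_zero (inv_ne_zero (huX q hq.2)) fun h => huX q hq.2 ?_
    rw [h, map_zero]
  · refine smul_ne_zero (inv_ne_zero (hvY q hq.1)) fun h => hvY q hq.1 ?_
    rw [h, map_zero]
  · have hsurj : Function.Surjective ((fderiv ℝ u q).prod (fderiv ℝ v q) : P2 →ₗ[ℝ] ℝ × ℝ) := by
      rintro ⟨s, t⟩
      refine ⟨(s / fderiv ℝ u q (X q)) • X q + (t / fderiv ℝ v q (Y q)) • Y q, ?_⟩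
      have h1 := huX q hq.2
      have h2 := hvY q hq.1
      ext
      · simp [huY q hq.2, h1]
      · simp [hvX q hq.1, h2]
    have hinj := (LinearMap.injective_iff_surjective_of_finrank_eq_finrank (by simp)).2 hsurj
    refine sub_eq_zero.1 (hinj ?_)
    rw [map_zero]
    refine Prod.ext ?_ ?_
    · refine key u 1 0 _ _ hu hW₁ hW₂ (fun q hq => ?_) (fun q hq => ?_) q hq
      · simp [huX q hq.2]
      · simp [huY q hq.2]
    · refine key v 0 1 _ _ hv hW₁ hW₂ (fun q hq => ?_) (fun q hq => ?_) q hq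
      · simp [hvX q hq.1]
      · simp [hvY q hq.1]

theorem exists_eq_smul_add_smul {v w : P2} (h : LinearIndependent ℝ ![v, w]) (z : P2) :
    ∃ s t : ℝ, s • v + t • w = z := by
  have h1 := h.span_eq_top_of_card_eq_finrank (by simp)
  have h2 : z ∈ Submodule.span ℝ (range ![v, w]) := h1 ▸ Submodule.mem_top
  rw [Matrix.range_cons, Matrix.range_cons, Matrix.range_empty, union_empty,
    singleton_union] at h2
  exact Submodule.mem_span_pair.1 h2

theorem trace_eq_add_of_eigenvectors {v w : P2} (h : LinearIndependent ℝ ![v, w])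
    {T : P2 →ₗ[ℝ] P2} {a b : ℝ} (hv : T v = a • v) (hw : T w = b • w) :
    LinearMap.trace ℝ P2 T = a + b := by
  let e := basisOfLinearIndependentOfCardEqFinrank h (by simp)
  have h0 : e 0 = v := by simp [e]
  have h1 : e 1 = w := by simp [e]
  rw [LinearMap.trace_eq_matrix_trace ℝ e, Matrix.trace_fin_two, LinearMap.toMatrix_apply,
    LinearMap.toMatrix_apply, h0, h1, hv, hw, ← h0, ← h1]
  simp

/-- Near a point where they differ, the eigenvalues of a smooth pencil are smooth, and there are
smooth fields of eigenvectors. -/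
theorem exists_smooth_eigenfields {F : Type*} [NormedAddCommGroup F] [NormedSpace ℝ F]
    [FiniteDimensional ℝ F] {f η : P2 → F} {U : Set P2} (hU : IsOpen U)
    (hf : ContDiffOn ℝ ∞ f U) (hη : ContDiffOn ℝ ∞ η U) {lam₁ lam₂ : P2 → ℝ}
    (hprin : ∀ q ∈ U, lam₂ q ≤ lam₁ q ∧ ∃ v₁ v₂ : P2, LinearIndependent ℝ ![v₁, v₂] ∧
        fderiv ℝ η q v₁ = lam₁ q • fderiv ℝ f q v₁ ∧
        fderiv ℝ η q v₂ = lam₂ q • fderiv ℝ f q v₂)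
    {p : P2} (hp : p ∈ U) (hinj : Function.Injective (fderiv ℝ f p)) (hlt : lam₂ p < lam₁ p) :
    ∃ (X₁ X₂ : P2 → P2) (O : Set P2), IsOpen O ∧ p ∈ O ∧ O ⊆ U ∧ ContDiffOn ℝ ∞ lam₁ O ∧
      ContDiffOn ℝ ∞ lam₂ O ∧ ContDiffOn ℝ ∞ X₁ O ∧ ContDiffOn ℝ ∞ X₂ O ∧
      LinearIndependent ℝ ![X₁ p, X₂ p] ∧ (∀ q ∈ O, lam₂ q < lam₁ q) ∧
      (∀ q ∈ O, fderiv ℝ η q (X₁ q) = lam₁ q • fderiv ℝ f q (X₁ q)) ∧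
      ∀ q ∈ O, fderiv ℝ η q (X₂ q) = lam₂ q • fderiv ℝ f q (X₂ q) := by
  obtain ⟨L', hL'⟩ := LinearMap.exists_leftInverse_of_injective
    (fderiv ℝ f p : P2 →ₗ[ℝ] F) (LinearMap.ker_eq_bot.2 hinj)
  let L : F →L[ℝ] P2 := LinearMap.toContinuousLinearMap L'
  let A : P2 → P2 →L[ℝ] P2 := fun q => L ∘L fderiv ℝ f q
  have hA : ContDiffOn ℝ ∞ A U := contDiffOn_const.clm_comp (hf.fderiv_of_isOpen hU (by simp))
  let R : Set (P2 →L[ℝ] P2) := range ContinuousLinearEquiv.toContinuousLinearMap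
  have hR : IsOpen R := ContinuousLinearEquiv.isOpen
  set O₁ := U ∩ A ⁻¹' R with hO₁_def
  have hO₁ : IsOpen O₁ := hA.continuousOn.isOpen_inter_preimage hU hR
  have hAp : A p = ContinuousLinearMap.id ℝ P2 := by
    ext1 v
    exact LinearMap.congr_fun hL' v
  have hpO₁ : p ∈ O₁ := ⟨hp, ⟨.refl ℝ P2, hAp.symm⟩⟩
  let B : P2 → P2 →L[ℝ] P2 := fun q => (A q).inverse ∘L (L ∘L fderiv ℝ η q)
  have hAinv : ContDiffOn ℝ ∞ (fun q => (A q).inverse) O₁ := by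
    intro q hq
    obtain ⟨e, he⟩ := hq.2
    refine ContDiffAt.comp_contDiffWithinAt (g := ContinuousLinearMap.inverse) (f := A) q ?_
      ((hA q hq.1).mono inter_subset_left)
    rw [← he]
    exact contDiffAt_map_inverse e
  have hB : ContDiffOn ℝ ∞ B O₁ := hAinv.clm_comp (contDiffOn_const.clm_comp
    ((hη.fderiv_of_isOpen hU (by simp)).mono inter_subset_left))
  have hBv : ∀ q ∈ O₁, ∀ (v : P2) (c : ℝ), fderiv ℝ η q v = c • fderiv ℝ f q v →
      B q v = c • v := by
    intro q hq v c hv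
    obtain ⟨e, he⟩ := hq.2
    change (A q).inverse (L (fderiv ℝ η q v)) = c • v
    have h1 : L (fderiv ℝ f q v) = e v := (DFunLike.congr_fun he v).symm
    rw [hv, map_smul, map_smul, h1, ← he, ContinuousLinearMap.inverse_equiv]
    simp
  let tr : (P2 →L[ℝ] P2) →L[ℝ] ℝ :=
    LinearMap.toContinuousLinearMap (LinearMap.trace ℝ P2 ∘ₗ ContinuousLinearMap.coeLM ℝ)
  have htr : ∀ q ∈ O₁, tr (B q) = lam₁ q + lam₂ q := by
    intro q hq
    obtain ⟨-, v₁, v₂, hv, h1, h2⟩ := hprin q hq.1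
    exact trace_eq_add_of_eigenvectors hv (hBv q hq v₁ _ h1) (hBv q hq v₂ _ h2)
  have htr2 : ∀ q ∈ O₁, tr (B q ∘L B q) = lam₁ q * lam₁ q + lam₂ q * lam₂ q := by
    intro q hq
    obtain ⟨-, v₁, v₂, hv, h1, h2⟩ := hprin q hq.1
    refine trace_eq_add_of_eigenvectors hv ?_ ?_
    · change B q (B q v₁) = _
      rw [hBv q hq v₁ _ h1, map_smul, hBv q hq v₁ _ h1, mul_smul]
    · change B q (B q v₂) = _
      rw [hBv q hq v₂ _ h2, map_smul, hBv q hq v₂ _ h2, mul_smul]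
  let disc : P2 → ℝ := fun q => 2 * tr (B q ∘L B q) - tr (B q) ^ 2
  have hdisc : ∀ q ∈ O₁, disc q = (lam₁ q - lam₂ q) ^ 2 := by
    intro q hq
    change 2 * tr (B q ∘L B q) - tr (B q) ^ 2 = _
    rw [htr q hq, htr2 q hq]; ring
  have htrs : ContDiffOn ℝ ∞ (fun q => tr (B q)) O₁ := tr.contDiff.comp_contDiffOn hB
  have hdiscs : ContDiffOn ℝ ∞ disc O₁ :=
    (contDiffOn_const.mul (tr.contDiff.comp_contDiffOn (hB.clm_comp hB))).sub (htrs.pow 2)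
  set O := O₁ ∩ disc ⁻¹' {0}ᶜ with hO_def
  have hO : IsOpen O := hdiscs.continuousOn.isOpen_inter_preimage hO₁ isOpen_compl_singleton
  have hOO₁ : O ⊆ O₁ := inter_subset_left
  have hpO : p ∈ O := by
    refine ⟨hpO₁, ?_⟩
    change disc p ≠ 0
    rw [hdisc p hpO₁]
    exact pow_ne_zero 2 (sub_pos.2 hlt).ne'
  have hsq : ContDiffOn ℝ ∞ (fun q => √(disc q)) O := (hdiscs.mono hOO₁).sqrt fun q hq => hq.2
  have hsq' : ∀ q ∈ O, √(disc q) = lam₁ q - lam₂ q := by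
    intro q hq
    rw [hdisc q hq.1, Real.sqrt_sq (sub_nonneg.2 (hprin q hq.1.1).1)]
  have hl₁ : ContDiffOn ℝ ∞ lam₁ O := by
    refine (((htrs.mono hOO₁).add hsq).div_const 2).congr fun q hq => ?_
    rw [hsq' q hq, htr q hq.1]; ring
  have hl₂ : ContDiffOn ℝ ∞ lam₂ O := by
    refine (((htrs.mono hOO₁).sub hsq).div_const 2).congr fun q hq => ?_
    rw [hsq' q hq, htr q hq.1]; ring
  obtain ⟨-, v₁, v₂, hv, hv1, hv2⟩ := hprin p hp
  refine ⟨fun q => B q v₁ - lam₂ q • v₁, fun q => B q v₂ - lam₁ q • v₂, O, hO, hpO,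
    fun q hq => hq.1.1, hl₁, hl₂,
    ((hB.mono hOO₁).clm_apply contDiffOn_const).sub (hl₂.smul contDiffOn_const),
    ((hB.mono hOO₁).clm_apply contDiffOn_const).sub (hl₁.smul contDiffOn_const), ?_,
    fun q hq => ?_, fun q hq => ?_, fun q hq => ?_⟩
  · rw [LinearIndependent.pair_iff] at hv ⊢
    intro s t hst
    beta_reduce at hst
    rw [hBv p hpO₁ v₁ _ hv1, hBv p hpO₁ v₂ _ hv2, ← sub_smul, ← sub_smul, smul_smul,
      smul_smul] at hst
    obtain ⟨h1, h2⟩ := hv _ _ hst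
    exact ⟨(mul_eq_zero.1 h1).resolve_right (sub_pos.2 hlt).ne',
      (mul_eq_zero.1 h2).resolve_right (sub_neg.2 hlt).ne⟩
  · refine lt_of_le_of_ne (hprin q hq.1.1).1 fun h => hq.2 ?_
    rw [mem_singleton_iff, hdisc q hq.1, h]; ring
  · obtain ⟨-, w₁, w₂, hw, hw1, hw2⟩ := hprin q hq.1.1
    obtain ⟨s, t, hst⟩ := exists_eq_smul_add_smul hw v₁
    have h : B q v₁ - lam₂ q • v₁ = (s * (lam₁ q - lam₂ q)) • w₁ := by
      rw [← hst, map_add, map_smul, map_smul, hBv q hq.1 w₁ _ hw1, hBv q hq.1 w₂ _ hw2]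
      module
    beta_reduce
    rw [h, map_smul, map_smul, hw1, smul_comm]
  · obtain ⟨-, w₁, w₂, hw, hw1, hw2⟩ := hprin q hq.1.1
    obtain ⟨s, t, hst⟩ := exists_eq_smul_add_smul hw v₂
    have h : B q v₂ - lam₁ q • v₂ = (t * (lam₂ q - lam₁ q)) • w₂ := by
      rw [← hst, map_add, map_smul, map_smul, hBv q hq.1 w₁ _ hw1, hBv q hq.1 w₂ _ hw2]
      module
    beta_reduce
    rw [h, map_smul, map_smul, hw2, smul_comm]

theorem IsLocalMax.fderiv_fderiv_apply_apply_nonpos {E : Type*} [NormedAddCommGroup E]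
    [NormedSpace ℝ E] {g : E → ℝ} {O : Set E} (hO : IsOpen O) (hg : ContDiffOn ℝ ∞ g O) {p : E}
    (hp : p ∈ O) (hmax : IsLocalMax g p) (w : E) : fderiv ℝ (fderiv ℝ g) p w w ≤ 0 := by
  by_contra! hpos
  let ℓ : ℝ → E := fun t => p + t • w
  have hℓ : ∀ t, HasDerivAt ℓ w t := fun t => by
    have h := ((hasDerivAt_id t).smul_const w).const_add p
    rwa [one_smul] at h
  have hℓ0 : ℓ 0 = p := by simp [ℓ]
  have hℓO : ∀ᶠ t in 𝓝 (0 : ℝ), ℓ t ∈ O :=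
    (hℓ 0).continuousAt.eventually (by rw [hℓ0]; exact hO.mem_nhds hp)
  have hd : ∀ t, ℓ t ∈ O → HasDerivAt (g ∘ ℓ) (fderiv ℝ g (ℓ t) w) t := fun t ht =>
    ((hg.contDiffAt (hO.mem_nhds ht)).differentiableAt (by simp)).hasFDerivAt.comp_hasDerivAt t
      (hℓ t)
  have hd' : deriv (g ∘ ℓ) =ᶠ[𝓝 0] fun t => fderiv ℝ g (ℓ t) w := by
    filter_upwards [hℓO] with t ht using (hd t ht).deriv
  have h2 : DifferentiableAt ℝ (fderiv ℝ g) (ℓ 0) := by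
    rw [hℓ0]
    exact ((hg.fderiv_of_isOpen (m := 1) hO (by norm_cast)).contDiffAt
      (hO.mem_nhds hp)).differentiableAt (by simp)
  have hdd : deriv (deriv (g ∘ ℓ)) 0 = fderiv ℝ (fderiv ℝ g) p w w := by
    rw [hd'.deriv_eq]
    have h3 := (h2.hasFDerivAt.comp_hasDerivAt 0 (hℓ 0)).clm_apply (hasDerivAt_const 0 w)
    simpa [hℓ0] using h3.deriv
  have hmax' : IsLocalMax (g ∘ ℓ) 0 := by
    have h := (hℓ 0).continuousAt.eventually (by rw [hℓ0]; exact hmax)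
    filter_upwards [h] with t ht
    simpa [hℓ0] using ht
  have hmin' : IsLocalMin (g ∘ ℓ) 0 :=
    isLocalMin_of_deriv_deriv_pos (hdd ▸ hpos) hmax'.deriv_eq_zero
      (hd 0 (hℓ0.symm ▸ hp)).continuousAt
  have hconst : g ∘ ℓ =ᶠ[𝓝 0] fun _ => (g ∘ ℓ) 0 := by
    filter_upwards [hmax', hmin'] with t h1 h2 using le_antisymm h1 h2
  have h0 : deriv (deriv (g ∘ ℓ)) 0 = 0 := by
    rw [hconst.deriv.deriv_eq]
    simp
  exact hpos.ne' (hdd ▸ h0)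

/-- The Codazzi equation in a commuting frame of principal directions. -/
theorem codazzi_of_commuting {E F : Type*} [NormedAddCommGroup E] [NormedSpace ℝ E]
    [NormedAddCommGroup F] [NormedSpace ℝ F] {f η : E → F} {lam₁ lam₂ : E → ℝ} {W₁ W₂ : E → E}
    {O : Set E} (hO : IsOpen O) (hf : ContDiffOn ℝ ∞ f O) (hη : ContDiffOn ℝ ∞ η O)
    (hl₁ : ContDiffOn ℝ ∞ lam₁ O) (hl₂ : ContDiffOn ℝ ∞ lam₂ O)
    (hW₁ : ContDiffOn ℝ ∞ W₁ O) (hW₂ : ContDiffOn ℝ ∞ W₂ O)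
    (h₁ : ∀ q ∈ O, fderiv ℝ η q (W₁ q) = lam₁ q • fderiv ℝ f q (W₁ q))
    (h₂ : ∀ q ∈ O, fderiv ℝ η q (W₂ q) = lam₂ q • fderiv ℝ f q (W₂ q))
    (hcomm : ∀ q ∈ O, fderiv ℝ W₂ q (W₁ q) = fderiv ℝ W₁ q (W₂ q)) {q : E} (hq : q ∈ O) :
    (lam₁ q - lam₂ q) • fderiv ℝ (fun r => fderiv ℝ f r (W₂ r)) q (W₁ q) =
      fderiv ℝ lam₂ q (W₁ q) • fderiv ℝ f q (W₂ q) -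
        fderiv ℝ lam₁ q (W₂ q) • fderiv ℝ f q (W₁ q) := by
  have hd : ∀ {g : E → ℝ}, ContDiffOn ℝ ∞ g O → DifferentiableAt ℝ g q := fun hg =>
    (hg.contDiffAt (hO.mem_nhds hq)).differentiableAt (by simp)
  have hV : ∀ {W : E → E}, ContDiffOn ℝ ∞ W O →
      DifferentiableAt ℝ (fun r => fderiv ℝ f r (W r)) q := fun hW => by
    refine (((hf.fderiv_of_isOpen (m := ∞) hO (by simp)).clm_apply hW).contDiffAt
      (hO.mem_nhds hq)).differentiableAt (by simp)
  have hf' := fderiv_fderiv_apply_sub hO hf hW₁ hW₂ hq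
  have hη' := fderiv_fderiv_apply_sub hO hη hW₁ hW₂ hq
  rw [hcomm q hq, sub_self, map_zero, sub_eq_zero] at hf' hη'
  have e₁ : (fun r => fderiv ℝ η r (W₁ r)) =ᶠ[𝓝 q] fun r => lam₁ r • fderiv ℝ f r (W₁ r) := by
    filter_upwards [hO.mem_nhds hq] with r hr using h₁ r hr
  have e₂ : (fun r => fderiv ℝ η r (W₂ r)) =ᶠ[𝓝 q] fun r => lam₂ r • fderiv ℝ f r (W₂ r) := by
    filter_upwards [hO.mem_nhds hq] with r hr using h₂ r hr
  rw [e₁.fderiv_eq, e₂.fderiv_eq, fderiv_fun_smul (hd hl₁) (hV hW₁),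
    fderiv_fun_smul (hd hl₂) (hV hW₂)] at hη'
  simp only [add_apply, smul_apply,
    ContinuousLinearMap.smulRight_apply] at hη'
  rw [← hf'] at hη'
  rw [sub_smul, sub_eq_sub_iff_add_eq_add, ← hη', add_comm]

end LocalTheory

/-- Let `lam₁ ≥ lam₂` be the principal curvature functions of
`M`, and let `p` be a point where the Minkowski Gaussian curvature is positive,
`lam₁` has a local maximum and `lam₂` a local minimum, and suppose `M` has
coercively convex curvature lines at `p`.  Then `p` is umbilic. -/
theorem local_extremum_umbilic (m : MinkowskiNorm3) (hadm : m.Admissible)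
    (S : BSurface m) (lam₁ lam₂ : P2 → ℝ)
    (hprin : ∀ q ∈ S.U, lam₂ q ≤ lam₁ q ∧
      ∃ v₁ v₂ : P2, LinearIndependent ℝ ![v₁, v₂] ∧
        fderiv ℝ S.η q v₁ = lam₁ q • fderiv ℝ S.f q v₁ ∧
        fderiv ℝ S.η q v₂ = lam₂ q • fderiv ℝ S.f q v₂)
    (p : P2) (hp : p ∈ S.U)
    (hK : 0 < lam₁ p * lam₂ p)
    (hmax : IsLocalMaxOn lam₁ S.U p) (hmin : IsLocalMinOn lam₂ S.U p)
    (hcoer : CoercivelyConvexAt m S lam₁ lam₂ p) :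
    lam₁ p = lam₂ p := by
  by_contra hne
  have hlt : lam₂ p < lam₁ p := lt_of_le_of_ne (hprin p hp).1 (Ne.symm hne)
  have hmax' : IsLocalMax lam₁ p := hmax.isLocalMax (S.isOpen.mem_nhds hp)
  have hmin' : IsLocalMin lam₂ p := hmin.isLocalMin (S.isOpen.mem_nhds hp)
  obtain ⟨X₁, X₂, O₁, hO₁, hpO₁, hO₁U, hl₁, hl₂, hX₁, hX₂, hX, hlt', he₁, he₂⟩ :=
    exists_smooth_eigenfields S.isOpen S.smooth_f S.smooth_η hprin hp (S.immersion p hp) hlt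
  obtain ⟨a, b, O, hO, hpO, hOO₁, hW₁, hW₂, hW0, hcomm⟩ :=
    exists_commuting_frame hO₁ hpO₁ hX₁ hX₂ hX
  replace hl₁ := hl₁.mono hOO₁
  replace hl₂ := hl₂.mono hOO₁
  have hOU : O ⊆ S.U := hOO₁.trans hO₁U
  have hgap : ∀ q ∈ O, lam₁ q - lam₂ q ≠ 0 := fun q hq => (sub_pos.2 (hlt' q (hOO₁ hq))).ne'
  have hη₁ : ∀ q ∈ O, fderiv ℝ S.η q (a q • X₁ q) = lam₁ q • fderiv ℝ S.f q (a q • X₁ q) := by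
    intro q hq
    rw [map_smul, map_smul, he₁ q (hOO₁ hq), smul_comm]
  have hη₂ : ∀ q ∈ O, fderiv ℝ S.η q (b q • X₂ q) = lam₂ q • fderiv ℝ S.f q (b q • X₂ q) := by
    intro q hq
    rw [map_smul, map_smul, he₂ q (hOO₁ hq), smul_comm]
  set W₁ : P2 → P2 := fun q => a q • X₁ q
  set W₂ : P2 → P2 := fun q => b q • X₂ q
  have hcod : ∀ q ∈ O, fderiv ℝ (fun r => fderiv ℝ S.f r (W₂ r)) q (W₁ q) =
      (fderiv ℝ lam₁ q (W₂ q) * -(lam₁ q - lam₂ q)⁻¹) • fderiv ℝ S.f q (W₁ q) +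
        (fderiv ℝ lam₂ q (W₁ q) * (lam₁ q - lam₂ q)⁻¹) • fderiv ℝ S.f q (W₂ q) := by
    intro q hq
    have h := codazzi_of_commuting hO (S.smooth_f.mono hOU) (S.smooth_η.mono hOU) hl₁ hl₂ hW₁ hW₂
      hη₁ hη₂ hcomm hq
    rw [(eq_inv_smul_iff₀ (hgap q hq)).2 h]
    module
  have hinv : ContDiffOn ℝ (⊤ : ℕ∞) (fun q => (lam₁ q - lam₂ q)⁻¹) O := (hl₁.sub hl₂).inv hgap
  have hN : ContDiffOn ℝ (⊤ : ℕ∞) (fun q => fderiv ℝ lam₁ q (W₂ q)) O :=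
    (hl₁.fderiv_of_isOpen hO (by simp)).clm_apply hW₂
  have hM : ContDiffOn ℝ (⊤ : ℕ∞) (fun q => fderiv ℝ lam₂ q (W₁ q)) O :=
    (hl₂.fderiv_of_isOpen hO (by simp)).clm_apply hW₁
  have h0 : fderiv ℝ (fun r => fderiv ℝ S.f r (W₂ r)) p (W₁ p) = 0 := by
    rw [hcod p hpO, hmax'.fderiv_eq_zero, hmin'.fderiv_eq_zero]
    simp
  have hneg := hcoer O hO hpO hOU W₁ W₂ _ _ hW₁ hW₂ (hN.mul hinv.neg) (hM.mul hinv)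
    (fun q hq => hW0 q hq) hη₁ hη₂ hcomm hcod h0
  have hd : ∀ {g : P2 → ℝ}, ContDiffOn ℝ (⊤ : ℕ∞) g O → DifferentiableAt ℝ g p := fun hg =>
    (hg.contDiffAt (hO.mem_nhds hpO)).differentiableAt (by simp)
  rw [fderiv_fun_mul (hd hN) (hd hinv.neg), hmax'.fderiv_eq_zero] at hneg
  simp only [zero_apply, zero_smul, zero_add, smul_apply, smul_eq_mul] at hneg
  rw [fderiv_fderiv_apply hO hl₁ hW₂ hpO, hmax'.fderiv_eq_zero, zero_apply, add_zero] at hneg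
  have hnonpos := IsLocalMax.fderiv_fderiv_apply_apply_nonpos hO hl₁ hpO hmax' (W₂ p)
  have hpos : 0 < (lam₁ p - lam₂ p)⁻¹ := inv_pos.2 (sub_pos.2 hlt)
  nlinarith
end
end
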